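/- arXiv:1005.3176 — 2 statements merged into one kernel-verified Lean document; each statement's English description precedes it below -/
import Mathlib

section
/- Let T > 0, a ≥ 0, b ≥ 0 with 2·a²·b·T < 1, and let g : [0,T] → ℝ be continuous with 0 ≤ g(t) and g(t) ≤ a + b·∫₀ᵗ g(s)³ ds for all t ∈ [0,T]. Then g(t) ≤ a/√(1 − 2a²bt) for all t ∈ [0,T]. -/
open Set intervalIntegral

lemma stmt4_aux (T c b : ℝ) (hc : 0 < c) (hb : 0 ≤ b)
    (G : ℝ → ℝ) (hG : Continuous G) (h0 : ∀ t ∈ Icc 0 T, 0 ≤ G t)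
    (hle : ∀ t ∈ Icc 0 T, G t ≤ c + b * ∫ s in (0:ℝ)..t, G s ^ 3) :
    ∀ t ∈ Icc 0 T, G t ^ 2 * (1 - 2 * c ^ 2 * b * t) ≤ c ^ 2 := by
  set h : ℝ → ℝ := fun t => c + b * ∫ s in (0:ℝ)..t, G s ^ 3 with hh
  have hd : ∀ t, HasDerivAt h (b * G t ^ 3) t := fun t =>
    (((hG.pow 3).integral_hasStrictDerivAt 0 t).hasDerivAt.const_mul b).const_add c
  have hpos : ∀ t ∈ Icc 0 T, 0 < h t := by
    intro t ht
    have : 0 ≤ ∫ s in (0:ℝ)..t, G s ^ 3 :=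
      intervalIntegral.integral_nonneg ht.1
        (fun s hs => pow_nonneg (h0 s ⟨hs.1, hs.2.trans ht.2⟩) 3)
    have := mul_nonneg hb this
    simp only [hh]; linarith
  have hd2 : ∀ t ∈ Icc 0 T, HasDerivAt (fun t => -(h t ^ 2)⁻¹)
      (2 * (b * G t ^ 3) / h t ^ 3) t := by
    intro t ht
    have hp := hpos t ht
    have := (((hd t).pow 2).inv (pow_pos hp 2).ne').neg
    refine this.congr_deriv ?_
    simp only [Pi.pow_apply]
    field_simp
    norm_num
    ring
  have key : ∀ ⦃t⦄, t ∈ Icc 0 T → -(h t ^ 2)⁻¹ ≤ -(c ^ 2)⁻¹ + 2 * b * t := by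
    refine image_le_of_deriv_right_le_deriv_boundary
      (f' := fun t => 2 * (b * G t ^ 3) / h t ^ 3) (B' := fun _ => 2 * b) ?_ ?_ ?_ ?_ ?_ ?_
    · exact fun t ht => (hd2 t ht).continuousAt.continuousWithinAt
    · exact fun t ht => (hd2 t ⟨ht.1, ht.2.le⟩).hasDerivWithinAt
    · simp [hh]
    · fun_prop
    · intro t _
      have := (((hasDerivAt_id t).const_mul (2 * b)).const_add (-(c ^ 2)⁻¹))
      simpa using this.hasDerivWithinAt
    · intro t ht
      have ht' : t ∈ Icc 0 T := ⟨ht.1, ht.2.le⟩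
      have hp := hpos t ht'
      have h3 : G t ^ 3 ≤ h t ^ 3 := pow_le_pow_left₀ (h0 t ht') (hle t ht') 3
      show 2 * (b * G t ^ 3) / h t ^ 3 ≤ 2 * b
      rw [div_le_iff₀ (pow_pos hp 3)]
      nlinarith [mul_le_mul_of_nonneg_left h3 hb]
  intro t ht
  have hp := hpos t ht
  have hk := key ht
  have h2 : G t ^ 2 ≤ h t ^ 2 := pow_le_pow_left₀ (h0 t ht) (hle t ht) 2
  have e1 : h t ^ 2 * (h t ^ 2)⁻¹ = 1 := mul_inv_cancel₀ (pow_pos hp 2).ne'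
  have e2 : c ^ 2 * (c ^ 2)⁻¹ = 1 := mul_inv_cancel₀ (pow_pos hc 2).ne'
  by_cases hs : 0 ≤ 1 - 2 * c ^ 2 * b * t
  · refine (mul_le_mul_of_nonneg_right h2 hs).trans ?_
    have h5 := mul_le_mul_of_nonneg_left hk (mul_pos (pow_pos hp 2) (pow_pos hc 2)).le
    have h6 : h t ^ 2 * c ^ 2 * -(h t ^ 2)⁻¹ = - c ^ 2 := by linear_combination (-c^2) * e1
    have h7 : h t ^ 2 * c ^ 2 * (-(c ^ 2)⁻¹ + 2 * b * t)
        = - (h t ^ 2 * (1 - 2 * c ^ 2 * b * t)) := by linear_combination (-h t^2) * e2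
    linarith
  · have := mul_nonpos_of_nonneg_of_nonpos (sq_nonneg (G t)) (not_le.1 hs).le
    linarith [sq_nonneg c]

/-- Nonlinear (cubic) Gronwall comparison inequality: if `0 ≤ g` is continuous on `[0,T]`
and `g t ≤ a + b ∫₀ᵗ g³`, with `2a²bT < 1`, then `g t ≤ a / √(1 - 2a²bt)` on `[0,T]`. -/
theorem stmt4 (T a b : ℝ) (hT : 0 < T) (ha : 0 ≤ a) (hb : 0 ≤ b)
    (hsmall : 2 * a ^ 2 * b * T < 1)
    (g : ℝ → ℝ) (hg : ContinuousOn g (Icc 0 T))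
    (hgnonneg : ∀ t ∈ Icc 0 T, 0 ≤ g t)
    (hgineq : ∀ t ∈ Icc 0 T, g t ≤ a + b * ∫ s in (0:ℝ)..t, g s ^ 3) :
    ∀ t ∈ Icc 0 T, g t ≤ a / Real.sqrt (1 - 2 * a ^ 2 * b * t) := by
  intro t ht
  set G : ℝ → ℝ := IccExtend hT.le ((Icc 0 T).domRestrict g) with hGdef
  have hG : Continuous G := (continuousOn_iff_continuous_domRestrict.1 hg).Icc_extend'
  have hGe : ∀ s ∈ Icc 0 T, G s = g s := fun s hs => by
    simp [hGdef, IccExtend_of_mem hT.le _ hs]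
  have hint : ∀ s ∈ Icc 0 T, ∫ u in (0:ℝ)..s, G u ^ 3 = ∫ u in (0:ℝ)..s, g u ^ 3 := by
    intro s hs
    refine intervalIntegral.integral_congr fun u hu => ?_
    rw [uIcc_of_le hs.1] at hu
    simp only [hGe u ⟨hu.1, hu.2.trans hs.2⟩]
  have hc : ∀ c, a < c → g t ^ 2 * (1 - 2 * c ^ 2 * b * t) ≤ c ^ 2 := by
    intro c hac
    rw [← hGe t ht]
    refine stmt4_aux T c b (ha.trans_lt hac) hb G hG ?_ ?_ t ht
    · intro s hs; rw [hGe s hs]; exact hgnonneg s hs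
    · intro s hs; rw [hGe s hs, hint s hs]; linarith [hgineq s hs]
  have hlim : g t ^ 2 * (1 - 2 * a ^ 2 * b * t) ≤ a ^ 2 := by
    have c1 : Continuous fun c : ℝ => g t ^ 2 * (1 - 2 * c ^ 2 * b * t) := by fun_prop
    have c2 : Continuous fun c : ℝ => c ^ 2 := by fun_prop
    refine le_of_tendsto_of_tendsto (b := nhdsWithin a (Ioi a))
      (c1.continuousAt.continuousWithinAt) (c2.continuousAt.continuousWithinAt) ?_
    filter_upwards [self_mem_nhdsWithin] with c hcc using hc c hcc
  have hpos : 0 < 1 - 2 * a ^ 2 * b * t := by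
    have : 2 * a ^ 2 * b * t ≤ 2 * a ^ 2 * b * T :=
      mul_le_mul_of_nonneg_left ht.2 (by positivity)
    linarith
  rw [le_div_iff₀ (Real.sqrt_pos.2 hpos)]
  refine (pow_le_pow_iff_left₀ (mul_nonneg (hgnonneg t ht) (Real.sqrt_nonneg _)) ha two_ne_zero).1 ?_
  rw [mul_pow, Real.sq_sqrt hpos.le]
  exact hlim
end

section
/- Let H be a real normed space, K ⊆ H a closed set, and T > 0. Let y : [0,T] → H be continuous and let y_n : [0,T] → H converge to y uniformly on [0,T]. Suppose there are functions v_n : [0,T] → H with v_n(t) ∈ K for all t ∈ [0,T] and with t ↦ ‖y_n(t) − v_n(t)‖ integrable on [0,T] such that ∫₀ᵀ ‖y_n(t) − v_n(t)‖ dt → 0 as n → ∞. Then y(t) ∈ K for every t ∈ [0,T]. -/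
open MeasureTheory Set Filter

/-- If `yₙ → y` uniformly on `[0,T]`, `vₙ t ∈ K` for all `t`, and
`∫₀ᵀ ‖yₙ - vₙ‖ → 0`, then the continuous limit `y` takes values in the closed set `K`. -/
theorem stmt10 {H : Type*} [NormedAddCommGroup H] [NormedSpace ℝ H]
    (K : Set H) (hK : IsClosed K) (T : ℝ) (hT : 0 < T)
    (y : ℝ → H) (hy : ContinuousOn y (Icc 0 T))
    (yN : ℕ → ℝ → H) (hconv : TendstoUniformlyOn yN y atTop (Icc 0 T))
    (vN : ℕ → ℝ → H) (hvK : ∀ n, ∀ t ∈ Icc 0 T, vN n t ∈ K)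
    (hint : ∀ n, IntegrableOn (fun t => ‖yN n t - vN n t‖) (Icc 0 T))
    (hto0 : Tendsto (fun n => ∫ t in Icc 0 T, ‖yN n t - vN n t‖) atTop (nhds 0)) :
    ∀ t ∈ Icc 0 T, y t ∈ K := by
  intro t₀ ht₀
  have hne : K.Nonempty := ⟨_, hvK 0 t₀ ht₀⟩
  by_contra hnot
  have hg0 : 0 < Metric.infDist (y t₀) K := (hK.notMem_iff_infDist_pos hne).1 hnot
  have hgc : ContinuousOn (fun t => Metric.infDist (y t) K) (Icc 0 T) :=
    (Metric.continuous_infDist_pt K).comp_continuousOn hy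
  have hpos : 0 < ∫ t in (0 : ℝ)..T, Metric.infDist (y t) K :=
    intervalIntegral.integral_pos hT hgc (fun _ _ => Metric.infDist_nonneg) ⟨t₀, ht₀, hg0⟩
  rw [intervalIntegral.integral_of_le hT.le, ← integral_Icc_eq_integral_Ioc] at hpos
  set I := ∫ t in Icc (0 : ℝ) T, Metric.infDist (y t) K with hI
  have hgi : IntegrableOn (fun t => Metric.infDist (y t) K) (Icc 0 T) :=
    hgc.integrableOn_compact isCompact_Icc
  have hε : 0 < I / (2 * T) := by positivity
  have h1 := Metric.tendstoUniformlyOn_iff.1 hconv _ hε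
  have h2 : ∀ᶠ n in atTop, (∫ t in Icc 0 T, ‖yN n t - vN n t‖) < I / 2 :=
    hto0.eventually (gt_mem_nhds (half_pos hpos))
  obtain ⟨n, hn1, hn2⟩ := (h1.and h2).exists
  have hc : IntegrableOn (fun _ : ℝ => I / (2 * T)) (Icc 0 T) :=
    continuousOn_const.integrableOn_compact isCompact_Icc
  have hle : I ≤ ∫ t in Icc 0 T, (I / (2 * T) + ‖yN n t - vN n t‖) := by
    refine setIntegral_mono_on hgi (hc.add (hint n)) measurableSet_Icc fun t ht => ?_
    have a := Metric.infDist_le_dist_of_mem (x := y t) (hvK n t ht)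
    have b := dist_triangle (y t) (yN n t) (vN n t)
    have c := hn1 t ht
    rw [dist_eq_norm (yN n t)] at b
    linarith
  rw [integral_add hc (hint n)] at hle
  have hconst : ∫ _ in Icc (0 : ℝ) T, I / (2 * T) = I / 2 := by
    rw [setIntegral_const, Real.volume_real_Icc_of_le hT.le, smul_eq_mul]
    field_simp
    ring
  linarith
end
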